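/- arXiv:1602.01617 — 3 statements merged into one kernel-verified Lean document; each statement's English description precedes it below -/
import Mathlib

section
/- Let N be an odd positive integer, and let n_i and m_i denote the sequences of odd numbers in the Collatz sequences of n_0 = N and m_0 = 2N + 1 respectively. Let r be the smallest integer such that n_{r+1} = (3n_r+1)/2^k with k > 1 (such r exists). Then m_i = 2n_i + 1 for all i ≤ r, m_{r+1} = 2^k·n_{r+1} + 1, and m_{r+2} = (3m_{r+1}+1)/2^j for some j > 1. Moreover, if k = 2, then m_i = n_i for all i > r + 1. -/
/-- One step of the Collatz map. -/
def collatzStep (n : ℕ) : ℕ := if Odd n then 3 * n + 1 else n / 2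

/-- For an odd number `a`, the next odd number occurring in the Collatz
sequence of `a`: `(3a+1)/2^v` where `2^v` is the largest power of `2`
dividing `3a+1`. -/
def nextOdd (a : ℕ) : ℕ := (3 * a + 1) / 2 ^ (3 * a + 1).factorization 2

/-- The sequence of odd numbers in the Collatz sequence of an odd number `A`. -/
def oddSeq (A : ℕ) (i : ℕ) : ℕ := nextOdd^[i] A

/-- Two Collatz sequences merge: they become equal after finitely many terms. -/
def collMerges (A B : ℕ) : Prop := ∃ i j, collatzStep^[i] A = collatzStep^[j] B

/-- Two Collatz sequences (of odd starting numbers) are equivalent: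
the second odd number occurring in each sequence is the same. -/
def collEquiv (A B : ℕ) : Prop := nextOdd A = nextOdd B

/-- `A` is a jump from `P` of height `d`:
`A = 4^d * P + 4^(d-1) + ... + 4 + 1`. -/
def isJump (A P d : ℕ) : Prop := 1 ≤ d ∧ A = 4 ^ d * P + (4 ^ d - 1) / 3

theorem two_pow_factorization_mul_nextOdd (a : ℕ) :
    2 ^ (3 * a + 1).factorization 2 * nextOdd a = 3 * a + 1 :=
  Nat.ordProj_mul_ordCompl_eq_self (3 * a + 1) 2

theorem odd_nextOdd (a : ℕ) : Odd (nextOdd a) := by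
  rw [← Nat.not_even_iff_odd, even_iff_two_dvd]
  exact Nat.not_dvd_ordCompl Nat.prime_two (Nat.succ_ne_zero _)

theorem nextOdd_eq_of_eq_two_pow_mul {a b v : ℕ} (hb : Odd b) (h : 3 * a + 1 = 2 ^ v * b) :
    nextOdd a = b := by
  have hv : (3 * a + 1).factorization 2 = v := by
    rw [h, Nat.factorization_mul (by positivity) hb.pos.ne', Nat.prime_two.factorization_pow,
      Finsupp.add_apply, Finsupp.single_eq_same,
      Nat.factorization_eq_zero_of_not_dvd hb.not_two_dvd_nat, add_zero]
  rw [nextOdd, hv, h, Nat.mul_div_cancel_left _ (by positivity)]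

theorem nextOdd_two_mul_add_one {n : ℕ} (hn : Odd n) : nextOdd (2 * n + 1) = 3 * n + 2 :=
  nextOdd_eq_of_eq_two_pow_mul (v := 1) (by grind) (by ring)

theorem nextOdd_four_mul_add_one (n : ℕ) : nextOdd (4 * n + 1) = nextOdd n := by
  refine nextOdd_eq_of_eq_two_pow_mul (v := (3 * n + 1).factorization 2 + 2) (odd_nextOdd n) ?_
  rw [pow_add, mul_right_comm, two_pow_factorization_mul_nextOdd]
  ring

theorem one_lt_factorization_of_four_dvd {a : ℕ} (h : 4 ∣ 3 * a + 1) :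
    1 < (3 * a + 1).factorization 2 :=
  (Nat.prime_two.pow_dvd_iff_le_factorization (k := 2) (Nat.succ_ne_zero _)).mp h

theorem oddSeq_succ (A i : ℕ) : oddSeq A (i + 1) = nextOdd (oddSeq A i) :=
  Function.iterate_succ_apply' nextOdd i A

theorem odd_oddSeq {A : ℕ} (hA : Odd A) (i : ℕ) : Odd (oddSeq A i) := by
  cases i with
  | zero => exact hA
  | succ i => rw [oddSeq_succ]; exact odd_nextOdd _

theorem stmt4 (N : ℕ) (hN : Odd N) (hNpos : 0 < N) (r k : ℕ) (hk : 1 < k)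
    (hr : 3 * oddSeq N r + 1 = 2 ^ k * oddSeq N (r + 1))
    (hrmin : ∀ i, i < r → 3 * oddSeq N i + 1 = 2 * oddSeq N (i + 1)) :
    (∀ i, i ≤ r → oddSeq (2 * N + 1) i = 2 * oddSeq N i + 1) ∧
    oddSeq (2 * N + 1) (r + 1) = 2 ^ k * oddSeq N (r + 1) + 1 ∧
    (∃ j, 1 < j ∧
      3 * oddSeq (2 * N + 1) (r + 1) + 1 = 2 ^ j * oddSeq (2 * N + 1) (r + 2)) ∧
    (k = 2 → ∀ i, r + 1 < i → oddSeq (2 * N + 1) i = oddSeq N i) := by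
  have hm : ∀ i, i ≤ r → oddSeq (2 * N + 1) i = 2 * oddSeq N i + 1 := by
    intro i hi
    induction i with
    | zero => rfl
    | succ i ih =>
      rw [oddSeq_succ, ih (by omega), nextOdd_two_mul_add_one (odd_oddSeq hN i)]
      have := hrmin i hi
      omega
  have hm' : oddSeq (2 * N + 1) (r + 1) = 2 ^ k * oddSeq N (r + 1) + 1 := by
    rw [oddSeq_succ, hm r le_rfl, nextOdd_two_mul_add_one (odd_oddSeq hN r), ← hr]
  refine ⟨hm, hm', ⟨_, one_lt_factorization_of_four_dvd (a := oddSeq (2 * N + 1) (r + 1)) ?_, ?_⟩, ?_⟩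
  · obtain ⟨c, hc⟩ : 4 ∣ 2 ^ k * oddSeq N (r + 1) :=
      (pow_dvd_pow 2 hk).mul_right _
    omega
  · rw [oddSeq_succ _ (r + 1)]
    exact (two_pow_factorization_mul_nextOdd _).symm
  · rintro rfl i hi
    induction i, hi using Nat.le_induction with
    | base => rw [oddSeq_succ, hm', oddSeq_succ N (r + 1)]; exact nextOdd_four_mul_add_one _
    | succ i _ ih => rw [oddSeq_succ, ih, oddSeq_succ N]
end

section
/- Let A be an odd number with A ≢ 0 mod 3, and let p_0 = A, p_1, p_2, ... denote the sequence of odd numbers in the reverse Collatz sequence of A. Then there exists k ≥ 1 such that p_0, ..., p_k are all defined and p_k ≢ 2 mod 3. Moreover, if p_k ≡ 1 mod 3, then p_k = 3n + 1 for some even number n, and p_{k+1} = 4n + 1. -/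
def revStep (a : ℕ) : ℕ := if Even a ∧ a % 3 = 1 then (a - 1) / 3 else 2 * a

/-- For an odd number `a` not divisible by `3`, the next odd number
occurring in the reverse Collatz sequence of `a`. -/
def revNextOdd (a : ℕ) : ℕ := if a % 3 = 2 then (2 * a - 1) / 3 else (4 * a - 1) / 3

/-- The sequence of odd numbers in the reverse Collatz sequence of `A`
(meaningful as long as the previous terms are not divisible by `3`). -/
def revOddSeq (A : ℕ) (i : ℕ) : ℕ := revNextOdd^[i] A

/-- The reverse Collatz sequence of `A` is trivial: `A` is the only odd
number occurring in it. -/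
def revTrivial (A : ℕ) : Prop := ∀ i, Odd (revStep^[i] A) → revStep^[i] A = A

/-- The reverse Collatz sequence of `A` converges: its subsequence of odd
numbers reaches a multiple of `3`. -/
def revConverges (A : ℕ) : Prop := ∃ i, Odd (revStep^[i] A) ∧ 3 ∣ revStep^[i] A

theorem revOddSeq_zero (A : ℕ) : revOddSeq A 0 = A := rfl

theorem revOddSeq_succ (A i : ℕ) : revOddSeq A (i + 1) = revOddSeq (revNextOdd A) i :=
  Function.iterate_succ_apply _ _ _

theorem revOddSeq_succ' (A i : ℕ) : revOddSeq A (i + 1) = revNextOdd (revOddSeq A i) :=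
  Function.iterate_succ_apply' _ _ _

theorem odd_revNextOdd {a : ℕ} (ha : Odd a) (h3 : ¬ 3 ∣ a) : Odd (revNextOdd a) := by
  rw [Nat.odd_iff] at *
  unfold revNextOdd
  split <;> omega

theorem revNextOdd_lt {a : ℕ} (h : a % 3 = 2) : revNextOdd a < a := by
  rw [revNextOdd, if_pos h]
  omega

theorem revNextOdd_three_mul_add_one (n : ℕ) : revNextOdd (3 * n + 1) = 4 * n + 1 := by
  rw [revNextOdd, if_neg (by omega)]
  omega

theorem odd_revOddSeq {A k : ℕ} (hA : Odd A) (h : ∀ i < k, ¬ 3 ∣ revOddSeq A i) :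
    Odd (revOddSeq A k) := by
  induction k with
  | zero => exact hA
  | succ k ih =>
    rw [revOddSeq_succ']
    exact odd_revNextOdd (ih fun i hi => h i (by omega)) (h k (by omega))

/-- The terms congruent to `2` modulo `3` strictly decrease, so such a run must end. -/
theorem exists_revOddSeq_mod_three_ne_two (A : ℕ) :
    ∃ k, (∀ i < k, ¬ 3 ∣ revOddSeq A i) ∧ revOddSeq A k % 3 ≠ 2 := by
  induction A using Nat.strong_induction_on with
  | _ A ih =>
    by_cases h : A % 3 = 2
    · obtain ⟨k, hk, hk2⟩ := ih _ (revNextOdd_lt h)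
      refine ⟨k + 1, fun i hi => ?_, by rwa [revOddSeq_succ]⟩
      cases i with
      | zero => rw [revOddSeq_zero]; omega
      | succ i => rw [revOddSeq_succ]; exact hk i (by omega)
    · exact ⟨0, by simp, h⟩

theorem stmt9 (A : ℕ) (hA : Odd A) (hA3 : ¬ (3 ∣ A)) :
    ∃ k, 1 ≤ k ∧ (∀ i, i < k → ¬ (3 ∣ revOddSeq A i)) ∧
      revOddSeq A k % 3 ≠ 2 ∧
      (revOddSeq A k % 3 = 1 →
        ∃ n, Even n ∧ revOddSeq A k = 3 * n + 1 ∧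
          revOddSeq A (k + 1) = 4 * n + 1) := by
  obtain ⟨k, hk, hk2⟩ := exists_revOddSeq_mod_three_ne_two (revNextOdd A)
  have hdef : ∀ i < k + 1, ¬ 3 ∣ revOddSeq A i := by
    intro i hi
    cases i with
    | zero => exact hA3
    | succ i => rw [revOddSeq_succ]; exact hk i (by omega)
  refine ⟨k + 1, by omega, hdef, by rwa [revOddSeq_succ], fun h1 => ?_⟩
  have hodd := Nat.odd_iff.mp (odd_revOddSeq hA hdef)
  have hn : revOddSeq A (k + 1) = 3 * (revOddSeq A (k + 1) / 3) + 1 := by omega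
  refine ⟨revOddSeq A (k + 1) / 3, Nat.even_iff.mpr (by omega), hn, ?_⟩
  rw [revOddSeq_succ' A (k + 1), ← revNextOdd_three_mul_add_one, ← hn]
end

section
/- Let t ≥ 0 and set p = 2t + 1. If t = 0, then the Collatz sequences of 24t + 21 = 21 and of 1 merge. If t > 0, write p = 2^k·n + 1 with n odd and k ≥ 1; if k > 2, then the Collatz sequences of 24t + 21 and of p merge, and otherwise (k = 1 or k = 2) the Collatz sequences of 24t + 21 and of 2p + 1 merge. -/
theorem collatzStep_two_mul_add_one (m : ℕ) : collatzStep (2 * m + 1) = 6 * m + 4 := by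
  rw [collatzStep, if_pos ⟨m, rfl⟩]
  ring

theorem collatzStep_two_mul (m : ℕ) : collatzStep (2 * m) = m := by
  rw [collatzStep, if_neg (by simp)]
  omega

theorem collatzStep_iterate_three_four_mul_add_one (m : ℕ) :
    collatzStep^[3] (4 * m + 1) = 3 * m + 1 := by
  simp only [Function.iterate_succ, Function.iterate_zero, Function.comp_apply, id_eq]
  rw [show 4 * m + 1 = 2 * (2 * m) + 1 by ring, collatzStep_two_mul_add_one,
    show 6 * (2 * m) + 4 = 2 * (2 * (3 * m + 1)) by ring, collatzStep_two_mul,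
    collatzStep_two_mul]

theorem collatzStep_iterate_three_four_mul_add_three (m : ℕ) :
    collatzStep^[3] (4 * m + 3) = 18 * m + 16 := by
  simp only [Function.iterate_succ, Function.iterate_zero, Function.comp_apply, id_eq]
  rw [show 4 * m + 3 = 2 * (2 * m + 1) + 1 by ring, collatzStep_two_mul_add_one,
    show 6 * (2 * m + 1) + 4 = 2 * (2 * (3 * m + 2) + 1) by ring, collatzStep_two_mul,
    collatzStep_two_mul_add_one]
  ring

theorem collMerges_twentyOne_one : collMerges 21 1 :=
  ⟨7, 0, by decide⟩

theorem collMerges_four_mul_add_three (t : ℕ) : collMerges (24 * t + 21) (4 * t + 3) := by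
  refine ⟨3, 3, ?_⟩
  rw [show 24 * t + 21 = 4 * (6 * t + 5) + 1 by ring,
    collatzStep_iterate_three_four_mul_add_one, collatzStep_iterate_three_four_mul_add_three]
  ring

theorem collMerges_eight_mul_add_one (m : ℕ) : collMerges (96 * m + 21) (8 * m + 1) := by
  refine ⟨2 + 3, 1 + 3, ?_⟩
  rw [Function.iterate_add_apply, Function.iterate_add_apply,
    show 96 * m + 21 = 4 * (24 * m + 5) + 1 by ring, show 8 * m + 1 = 4 * (2 * m) + 1 by ring,
    collatzStep_iterate_three_four_mul_add_one, collatzStep_iterate_three_four_mul_add_one]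
  simp only [Function.iterate_succ, Function.iterate_zero, Function.comp_apply, id_eq]
  rw [show 3 * (24 * m + 5) + 1 = 2 * (2 * (18 * m + 4)) by ring, collatzStep_two_mul,
    collatzStep_two_mul, show 3 * (2 * m) + 1 = 2 * (3 * m) + 1 by ring,
    collatzStep_two_mul_add_one]
  ring

theorem stmt15 (t p : ℕ) (hp : p = 2 * t + 1) :
    (t = 0 → collMerges (24 * t + 21) 1) ∧
    (0 < t → ∀ k n, Odd n → 1 ≤ k → p = 2 ^ k * n + 1 →
      (2 < k → collMerges (24 * t + 21) p) ∧
      (k ≤ 2 → collMerges (24 * t + 21) (2 * p + 1))) := by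
  refine ⟨?_, fun _ k n _ _ hk => ⟨fun h => ?_, fun _ => ?_⟩⟩
  · rintro rfl
    exact collMerges_twentyOne_one
  · obtain ⟨m, hm⟩ : 2 ^ 3 ∣ 2 ^ k * n := (pow_dvd_pow 2 h).mul_right n
    obtain rfl : t = 4 * m := by omega
    convert collMerges_eight_mul_add_one m using 1 <;> omega
  · convert collMerges_four_mul_add_three t using 1
    omega
end
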